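/- Assertion correctness of the augmented library (abstract form of the paper's Theorem 3.2(a)): under the hypotheses of the basis-preserving-executions-are-safe lemma (states σ₀,…,σₙ with executing threads tᵢ, invariant map μ with μ u a positive boolean combination over pm u at every program point u, conditions (i)–(iii) as there), suppose additionally that for each step i at which the executing thread tᵢ is active, an assertion φᵢ : Σ → T → Prop is attached to the edge executed from uᵢ = pc σᵢ tᵢ and the sequential proof obligation holds: for all σ and t, μ uᵢ σ t implies φᵢ σ t. Then every assertion is satisfied in the concurrent execution: φᵢ σᵢ tᵢ holds for every such step i. -/

import Mathlib

/-- A positive boolean combination over a set `S` of thread-indexed predicates: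
built from members of `S` by finitely many pointwise conjunctions and disjunctions. -/
inductive PosComb {St T : Type*} (S : Set (St → T → Prop)) : (St → T → Prop) → Prop
  | base {p : St → T → Prop} : p ∈ S → PosComb S p
  | and {p q : St → T → Prop} : PosComb S p → PosComb S q →
      PosComb S (fun σ t => p σ t ∧ q σ t)
  | or {p q : St → T → Prop} : PosComb S p → PosComb S q →
      PosComb S (fun σ t => p σ t ∨ q σ t)

/-- A positive boolean combination is preserved whenever all its basis predicates are. -/
theorem PosComb.preserved {St T : Type*} {S : Set (St → T → Prop)} {p : St → T → Prop}
    (hp : PosComb S p) {s s' : St} {t : T} (h : ∀ φ ∈ S, φ s t → φ s' t) :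
    p s t → p s' t := by
  induction hp with
  | base hmem => exact h _ hmem
  | and _ _ ihp ihq => exact And.imp ihp ihq
  | or _ _ ihp ihq => exact Or.imp ihp ihq

/-- In a basis-preserving execution, every thread is inactive or safe in every state. -/
theorem inactive_or_safe {St T V : Type*} (w : V) (pc : St → T → V)
    (μ : V → (St → T → Prop)) (pm : V → Set (St → T → Prop))
    (hbasis : ∀ u : V, PosComb (pm u) (μ u))
    (n : ℕ) (σ : ℕ → St) (tex : ℕ → T)
    (h0 : ∀ t : T, pc (σ 0) t = w)
    (hii : ∀ i < n, ∀ t : T, t ≠ tex i →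
      (pc (σ i) t ≠ w →
        pc (σ (i + 1)) t = pc (σ i) t ∧
        ∀ φ ∈ pm (pc (σ i) t), φ (σ i) t → φ (σ (i + 1)) t) ∧
      (pc (σ i) t = w → pc (σ (i + 1)) t = w))
    (hiii : ∀ i < n,
      (pc (σ i) (tex i) ≠ w → μ (pc (σ i) (tex i)) (σ i) (tex i) →
        pc (σ (i + 1)) (tex i) = w ∨
          μ (pc (σ (i + 1)) (tex i)) (σ (i + 1)) (tex i)) ∧
      (pc (σ i) (tex i) = w →
        pc (σ (i + 1)) (tex i) = w ∨
          μ (pc (σ (i + 1)) (tex i)) (σ (i + 1)) (tex i))) :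
    ∀ i ≤ n, ∀ t : T, pc (σ i) t = w ∨ μ (pc (σ i) t) (σ i) t := by
  intro i
  induction i with
  | zero => exact fun _ t => Or.inl (h0 t)
  | succ k ih =>
    intro hk t
    have hsafe := ih (Nat.le_of_succ_le hk) t
    by_cases ht : t = tex k
    · subst ht
      by_cases hw : pc (σ k) (tex k) = w
      · exact (hiii k hk).2 hw
      · exact (hiii k hk).1 hw (hsafe.resolve_left hw)
    · by_cases hw : pc (σ k) t = w
      · exact Or.inl ((hii k hk t ht).2 hw)
      · obtain ⟨hpc, hpres⟩ := (hii k hk t ht).1 hw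
        rw [hpc]
        exact Or.inr ((hbasis _).preserved hpres (hsafe.resolve_left hw))

/-- Assertion correctness of the augmented library: under the hypotheses of the
basis-preserving-executions-are-safe lemma, if at each step `i` where the executing
thread is active, the assertion `φa i` attached to the executed edge is implied by the
invariant at the executing thread's program point, then every assertion is satisfied
in the concurrent execution. -/
theorem assertions_hold {St T V : Type*} (w : V) (pc : St → T → V)
    (μ : V → (St → T → Prop)) (pm : V → Set (St → T → Prop))
    (hbasis : ∀ u : V, PosComb (pm u) (μ u))
    (n : ℕ) (σ : ℕ → St) (tex : ℕ → T)
    (h0 : ∀ t : T, pc (σ 0) t = w)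
    (hii : ∀ i < n, ∀ t : T, t ≠ tex i →
      (pc (σ i) t ≠ w →
        pc (σ (i + 1)) t = pc (σ i) t ∧
        ∀ φ ∈ pm (pc (σ i) t), φ (σ i) t → φ (σ (i + 1)) t) ∧
      (pc (σ i) t = w → pc (σ (i + 1)) t = w))
    (hiii : ∀ i < n,
      (pc (σ i) (tex i) ≠ w → μ (pc (σ i) (tex i)) (σ i) (tex i) →
        pc (σ (i + 1)) (tex i) = w ∨
          μ (pc (σ (i + 1)) (tex i)) (σ (i + 1)) (tex i)) ∧
      (pc (σ i) (tex i) = w →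
        pc (σ (i + 1)) (tex i) = w ∨
          μ (pc (σ (i + 1)) (tex i)) (σ (i + 1)) (tex i)))
    (φa : ℕ → (St → T → Prop))
    (hseq : ∀ i < n, pc (σ i) (tex i) ≠ w →
      ∀ (s : St) (t : T), μ (pc (σ i) (tex i)) s t → φa i s t) :
    ∀ i < n, pc (σ i) (tex i) ≠ w → φa i (σ i) (tex i) := by
  intro i hi hw
  exact hseq i hi hw _ _
    ((inactive_or_safe w pc μ pm hbasis n σ tex h0 hii hiii i hi.le (tex i)).resolve_left hw)
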